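/- Fix a real number h > 0 and an integer m, and define Z_{α,β} : ℝ³ → ℂ by Z_{α,β}(r,c,s) = i·α·h·(c − β·r) + (β·h·c − s + ((α² − β²)·h/2)·r). Then for α > 0 and β ∈ ℝ, the complex numbers Z_{α,β}(1,0,1) and Z_{α,β}(0,1,m) are ℝ-linearly dependent if and only if (β − m/h)² + α² = (m² + 2h)/h². In particular this locus is a semicircle in the upper half plane passing through the point (β,α) = (0, √(2/h)). -/

import Mathlib

open Complex

/-- The central charge `Z_{α,β}` on `ℝ³`. -/
noncomputable def Zcc (h α β : ℝ) (u : ℝ × ℝ × ℝ) : ℂ :=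
  I * (α : ℂ) * (h : ℂ) * ((u.2.1 : ℂ) - (β : ℂ) * (u.1 : ℂ)) +
    ((β : ℂ) * (h : ℂ) * (u.2.1 : ℂ) - (u.2.2 : ℂ) +
      (((α : ℂ) ^ 2 - (β : ℂ) ^ 2) * (h : ℂ) / 2) * (u.1 : ℂ))

theorem Zcc_re (h α β r c s : ℝ) :
    (Zcc h α β (r, c, s)).re = β * h * c - s + (α ^ 2 - β ^ 2) * h / 2 * r := by
  simp [Zcc, pow_two]

theorem Zcc_im (h α β r c s : ℝ) :
    (Zcc h α β (r, c, s)).im = α * h * (c - β * r) := by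
  simp [Zcc, pow_two]

/-- Linear independence of two complex numbers over `ℝ` is non-vanishing of their determinant. -/
theorem linearIndependent_pair_iff_det_ne_zero (z w : ℂ) :
    LinearIndependent ℝ ![z, w] ↔ z.re * w.im - z.im * w.re ≠ 0 := by
  rw [LinearIndependent.pair_iff]
  constructor
  · intro H hdet
    have hre := H w.re (-z.re) (by
      apply Complex.ext <;> simp <;> linarith)
    have him := H w.im (-z.im) (by
      apply Complex.ext <;> simp <;> linarith)
    have hz : z = 0 := Complex.ext (by simpa using hre.2) (by simpa using him.2)
    simpa using H 1 0 (by simp [hz])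
  · intro hdet s t hst
    have hre : s * z.re + t * w.re = 0 := by simpa using congrArg Complex.re hst
    have him : s * z.im + t * w.im = 0 := by simpa using congrArg Complex.im hst
    constructor
    · apply (mul_eq_zero.mp _).resolve_right hdet
      linear_combination w.im * hre - w.re * him
    · apply (mul_eq_zero.mp _).resolve_right hdet
      linear_combination z.re * him - z.im * hre

theorem gieseker_wall_is_semicircle (h : ℝ) (hh : 0 < h) (m : ℤ) :
    (∀ α β : ℝ, 0 < α →
      (¬ LinearIndependent ℝ ![Zcc h α β (1, 0, 1), Zcc h α β (0, 1, (m : ℝ))] ↔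
        (β - (m : ℝ) / h) ^ 2 + α ^ 2 = ((m : ℝ) ^ 2 + 2 * h) / h ^ 2)) ∧
    -- the semicircle passes through the point (β, α) = (0, √(2/h))
    ((0 - (m : ℝ) / h) ^ 2 + Real.sqrt (2 / h) ^ 2 = ((m : ℝ) ^ 2 + 2 * h) / h ^ 2) := by
  refine ⟨fun α β hα => ?_, ?_⟩
  · rw [linearIndependent_pair_iff_det_ne_zero, not_not, Zcc_re, Zcc_im, Zcc_re, Zcc_im]
    have hdet : (β * h * 0 - 1 + (α ^ 2 - β ^ 2) * h / 2 * 1) * (α * h * (1 - β * 0)) -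
        α * h * (0 - β * 1) * (β * h * 1 - m + (α ^ 2 - β ^ 2) * h / 2 * 0) =
        α * h ^ 2 / 2 * ((β - m / h) ^ 2 + α ^ 2 - ((m : ℝ) ^ 2 + 2 * h) / h ^ 2) := by
      field_simp
      ring
    have hpos : α * h ^ 2 / 2 ≠ 0 := by positivity
    rw [hdet, mul_eq_zero, or_iff_right hpos, sub_eq_zero]
  · rw [Real.sq_sqrt (by positivity)]
    field_simp
    ring
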